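/- arXiv:2007.05787 — 2 statements merged into one kernel-verified Lean document; each statement's English description precedes it below -/
import Mathlib

section
/- Weighted-to-unweighted Sobolev embedding: Let j ≥ 1 be an integer and σ an integer with 0 < σ ≤ j. Then there is a constant C = C(d, j, σ) such that for every f smooth on the closed half-space and compactly supported, Σ_{|α|≤j−σ} ‖∂^α f‖_{L²(H)} ≤ C Σ_{|α|≤j} ‖x_d^{σ} ∂^α f‖_{L²(H)}; i.e., H^{j,σ} ⊂ H^{j−σ}. -/
open MeasureTheory Set

noncomputable section

/-- The half-space `H = {x ∈ ℝ^{d+1} : x_last > 0}`. -/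
def HS (d : ℕ) : Set (Fin (d + 1) → ℝ) := {x | 0 < x (Fin.last d)}

/-- The weighted `L²` norm `‖x_d^σ g‖_{L²(H)}`. -/
def wL2 (d : ℕ) (σ : ℝ) (g : (Fin (d + 1) → ℝ) → ℝ) : ℝ :=
  Real.sqrt (∫ x in HS d, x (Fin.last d) ^ (2 * σ : ℝ) * g x ^ 2)

/-- The weighted Sobolev norm `Σ_{n≤j} ‖x_d^σ |∂^n f|‖_{L²(H)}`, with the full `n`-th
derivative measured by `iteratedFDeriv`. -/
def sobNorm (d : ℕ) (j : ℕ) (σ : ℝ) (f : (Fin (d + 1) → ℝ) → ℝ) : ℝ :=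
  ∑ n ∈ Finset.range (j + 1), wL2 d σ (fun x => ‖iteratedFDeriv ℝ n f x‖)

/-- Hardy's inequality on the half-line for vector-valued functions. -/
theorem hardy_halfLine {F : Type*} [NormedAddCommGroup F] [NormedSpace ℝ F] [CompleteSpace F]
    {g : ℝ → F} (hg : ContDiff ℝ 1 g) (hc : HasCompactSupport g) (s : ℕ) :
    ∫ t in Ioi (0 : ℝ), t ^ (2 * s) * ‖g t‖ ^ 2 ≤
      4 * ∫ t in Ioi (0 : ℝ), t ^ (2 * (s + 1)) * ‖deriv g t‖ ^ 2 := by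
  obtain ⟨R, hR0, hR⟩ : ∃ R : ℝ, 0 < R ∧ ∀ t, R ≤ t → g t = 0 ∧ deriv g t = 0 := by
    obtain ⟨R, hR⟩ := hc.isCompact.isBounded.subset_closedBall (0 : ℝ)
    refine ⟨max R 0 + 1, by positivity, fun t ht => ?_⟩
    have h : t ∉ tsupport g := fun h => by
      have h' := hR h
      rw [mem_closedBall_zero_iff, Real.norm_eq_abs] at h'
      linarith [le_abs_self t, le_max_left R 0]
    exact ⟨image_eq_zero_of_notMem_tsupport h,
      image_eq_zero_of_notMem_tsupport fun h' => h (tsupport_deriv_subset (𝕜 := ℝ) h')⟩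
  have hd : Continuous (deriv g) := hg.continuous_deriv le_rfl
  have truncate (φ : ℝ → ℝ) (hφ : ∀ t, R ≤ t → φ t = 0) :
      ∫ t in Ioi (0 : ℝ), φ t = ∫ t in (0 : ℝ)..R, φ t := by
    rw [intervalIntegral.integral_of_le hR0.le]
    refine setIntegral_eq_of_subset_of_forall_sdiff_eq_zero measurableSet_Ioi
      Ioc_subset_Ioi_self fun t ht => hφ t ?_
    by_contra! h
    exact ht.2 ⟨ht.1, h.le⟩
  rw [truncate _ fun t ht => by simp [(hR t ht).1], truncate _ fun t ht => by simp [(hR t ht).2]]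
  set v : ℝ → ℝ := fun t => ‖deriv g t‖ with hv
  have hvc : Continuous v := hd.norm
  set U : ℝ → ℝ := fun t => ∫ x in t..R, v x with hU
  have hUd (t : ℝ) : HasDerivAt U (-v t) t :=
    intervalIntegral.integral_hasDerivAt_left (hvc.intervalIntegrable _ _)
      hvc.stronglyMeasurable.stronglyMeasurableAtFilter hvc.continuousAt
  have hUc : Continuous U := continuous_iff_continuousAt.2 fun t => (hUd t).continuousAt
  have hgU (t : ℝ) (ht : t ≤ R) : ‖g t‖ ≤ U t := by
    have h := intervalIntegral.integral_deriv_eq_sub (a := t) (b := R)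
      (fun x _ => (hg.differentiable one_ne_zero) x) (hd.intervalIntegrable _ _)
    rw [(hR R le_rfl).1, zero_sub] at h
    rw [← norm_neg, ← h]
    exact intervalIntegral.norm_integral_le_integral_norm ht
  have byParts : ∫ t in (0 : ℝ)..R,
      (((2 * s + 1 : ℕ) : ℝ) * t ^ (2 * s) * U t ^ 2
        + t ^ (2 * s + 1) * (2 * U t * -v t)) = 0 := by
    rw [intervalIntegral.integral_eq_sub_of_hasDerivAt
      (f := fun t => t ^ (2 * s + 1) * U t ^ 2)]
    · simp [hU]
    · intro t _
      refine ((hasDerivAt_pow (2 * s + 1) t).mul ((hUd t).pow 2)).congr_deriv ?_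
      simp
    · exact Continuous.intervalIntegrable (by fun_prop) _ _
  have step : ∫ t in (0 : ℝ)..R, t ^ (2 * s) * ‖g t‖ ^ 2 ≤
      ∫ t in (0 : ℝ)..R, (4 * (t ^ (2 * (s + 1)) * v t ^ 2)
        + (2 * (((2 * s + 1 : ℕ) : ℝ) * t ^ (2 * s) * U t ^ 2
          + t ^ (2 * s + 1) * (2 * U t * -v t)))) := by
    have hgc := hg.continuous
    refine intervalIntegral.integral_mono_on hR0.le
      (Continuous.intervalIntegrable (by fun_prop) _ _)
      (Continuous.intervalIntegrable (by fun_prop) _ _) fun t ht => ?_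
    have h1 : ‖g t‖ ^ 2 ≤ U t ^ 2 := pow_le_pow_left₀ (norm_nonneg _) (hgU t ht.2) 2
    have h2 : (0 : ℝ) ≤ t ^ (2 * s) := pow_nonneg ht.1 _
    have h3 : 0 ≤ t ^ (2 * s) * (2 * t * v t - U t) ^ 2 := by positivity
    have h4 : 0 ≤ (s : ℝ) * (t ^ (2 * s) * U t ^ 2) := by positivity
    calc t ^ (2 * s) * ‖g t‖ ^ 2 ≤ t ^ (2 * s) * U t ^ 2 := by gcongr
      _ ≤ t ^ (2 * s) * U t ^ 2 + t ^ (2 * s) * (2 * t * v t - U t) ^ 2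
          + 4 * ((s : ℝ) * (t ^ (2 * s) * U t ^ 2)) := by linarith
      _ = _ := by push_cast; ring
  refine step.trans_eq ?_
  rw [intervalIntegral.integral_add (Continuous.intervalIntegrable (by fun_prop) _ _)
    (Continuous.intervalIntegrable (by fun_prop) _ _), intervalIntegral.integral_const_mul,
    intervalIntegral.integral_const_mul, byParts, mul_zero, add_zero]

/-- Fubini on the half-space, integrating over the last coordinate first. -/
theorem setIntegral_HS_eq {d : ℕ} {φ : (Fin (d + 1) → ℝ) → ℝ} (hφ : Integrable φ) :
    Integrable (fun y : Fin d → ℝ =>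
        ∫ t in Ioi (0 : ℝ), φ ((Fin.last d).insertNth (α := fun _ => ℝ) t y)) ∧
      ∫ x in HS d, φ x = ∫ y : Fin d → ℝ,
        ∫ t in Ioi (0 : ℝ), φ ((Fin.last d).insertNth (α := fun _ => ℝ) t y) := by
  set e := MeasurableEquiv.piFinSuccAbove (fun _ : Fin (d + 1) => ℝ) (Fin.last d) with he
  have hmp : MeasurePreserving e.symm (volume.prod volume) volume :=
    (volume_preserving_piFinSuccAbove (fun _ : Fin (d + 1) => ℝ) (Fin.last d)).symm
  have hint : Integrable (fun p => φ (e.symm p)) (volume.prod volume) :=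
    (hmp.integrable_comp_emb e.symm.measurableEmbedding).2 hφ
  have hpre : e.symm ⁻¹' HS d = Ioi (0 : ℝ) ×ˢ (univ : Set (Fin d → ℝ)) := by
    ext p
    simp [HS, he, MeasurableEquiv.piFinSuccAbove]
  have hres : Integrable (fun p => φ (e.symm p))
      ((volume.restrict (Ioi (0 : ℝ))).prod (volume : Measure (Fin d → ℝ))) := by
    have := hint.restrict (s := Ioi (0 : ℝ) ×ˢ (univ : Set (Fin d → ℝ)))
    rwa [← Measure.prod_restrict, Measure.restrict_univ] at this
  refine ⟨hres.integral_prod_right, ?_⟩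
  rw [← hmp.setIntegral_preimage_emb e.symm.measurableEmbedding, hpre, ← Measure.prod_restrict,
    Measure.restrict_univ, integral_prod_symm _ hres]
  rfl

/-- Hardy's inequality on the half-space for vector-valued functions. -/
theorem hardy_HS {F : Type*} [NormedAddCommGroup F] [NormedSpace ℝ F] [CompleteSpace F]
    {d : ℕ} {g : (Fin (d + 1) → ℝ) → F} (hg : ContDiff ℝ 1 g) (hc : HasCompactSupport g)
    (s : ℕ) :
    ∫ x in HS d, x (Fin.last d) ^ (2 * s) * ‖g x‖ ^ 2 ≤
      4 * ∫ x in HS d, x (Fin.last d) ^ (2 * (s + 1)) * ‖fderiv ℝ g x‖ ^ 2 := by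
  have hgc := hg.continuous
  have hdc : Continuous (fderiv ℝ g) := hg.continuous_fderiv one_ne_zero
  have int0 : Integrable fun x => x (Fin.last d) ^ (2 * s) * ‖g x‖ ^ 2 := by
    refine Continuous.integrable_of_hasCompactSupport (by fun_prop) (hc.mono fun x hx h => hx ?_)
    simp [h]
  have int1 : Integrable fun x => x (Fin.last d) ^ (2 * (s + 1)) * ‖fderiv ℝ g x‖ ^ 2 := by
    refine Continuous.integrable_of_hasCompactSupport (by fun_prop)
      ((hc.fderiv ℝ).mono fun x hx h => hx ?_)
    simp [h]
  obtain ⟨i0, e0⟩ := setIntegral_HS_eq int0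
  obtain ⟨i1, e1⟩ := setIntegral_HS_eq int1
  rw [e0, e1, ← integral_const_mul]
  refine integral_mono i0 (i1.const_mul 4) fun y => ?_
  set γ : ℝ → Fin (d + 1) → ℝ := fun t => (Fin.last d).insertNth (α := fun _ => ℝ) t y with hγ
  have hγl (t : ℝ) : γ t (Fin.last d) = t := by simp [hγ]
  have hγd (t : ℝ) : HasDerivAt γ (Pi.single (Fin.last d) 1) t := by
    rw [hasDerivAt_pi]
    intro i
    refine Fin.lastCases ?_ (fun i => ?_) i
    · simpa [hγ] using hasDerivAt_id' t
    · simpa [hγ] using hasDerivAt_const t (y i)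
  have hγc : ContDiff ℝ 1 γ := by
    rw [contDiff_pi]
    intro i
    refine Fin.lastCases ?_ (fun i => ?_) i
    · simpa [hγ] using contDiff_fun_id
    · simpa [hγ] using contDiff_const
  have hcomp : HasCompactSupport (g ∘ γ) := by
    refine HasCompactSupport.of_support_subset_isCompact
      (hc.isCompact.image (continuous_apply (Fin.last d))) fun t ht => ?_
    exact ⟨γ t, subset_tsupport _ ht, hγl t⟩
  have hder (t : ℝ) : ‖deriv (g ∘ γ) t‖ ≤ ‖fderiv ℝ g (γ t)‖ := by
    rw [(((hg.differentiable one_ne_zero) (γ t)).hasFDerivAt.comp_hasDerivAt t (hγd t)).deriv]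
    exact (ContinuousLinearMap.le_opNorm _ _).trans_eq
      (by rw [Pi.norm_single, norm_one, mul_one])
  have hcd := hg.comp hγc
  have hγcc := hγc.continuous
  have hdd : Continuous (deriv (g ∘ γ)) := hcd.continuous_deriv le_rfl
  have key := hardy_halfLine hcd hcomp s
  change ∫ t in Ioi (0 : ℝ), γ t (Fin.last d) ^ (2 * s) * ‖g (γ t)‖ ^ 2 ≤
    4 * ∫ t in Ioi (0 : ℝ), γ t (Fin.last d) ^ (2 * (s + 1)) * ‖fderiv ℝ g (γ t)‖ ^ 2
  simp only [hγl]
  refine key.trans (mul_le_mul_of_nonneg_left ?_ (by norm_num))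
  refine setIntegral_mono_on ?_ ?_ measurableSet_Ioi fun t ht => ?_
  · refine (Continuous.integrable_of_hasCompactSupport (by fun_prop)
      (hcomp.deriv.mono fun x hx h => hx ?_)).integrableOn
    simp [h]
  · refine (Continuous.integrable_of_hasCompactSupport (by fun_prop)
      (HasCompactSupport.of_support_subset_isCompact
        ((hc.fderiv ℝ).isCompact.image (continuous_apply (Fin.last d)))
        fun t ht => ⟨γ t, subset_tsupport _ fun h => ht ?_, hγl t⟩)).integrableOn
    simp [h]
  · have h0 : (0 : ℝ) ≤ t := (mem_Ioi.1 ht).le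
    gcongr
    exact hder t

theorem wL2_natCast (d s : ℕ) (g : (Fin (d + 1) → ℝ) → ℝ) :
    wL2 d s g = Real.sqrt (∫ x in HS d, x (Fin.last d) ^ (2 * s) * g x ^ 2) := by
  unfold wL2
  congr 2
  funext x
  rw [show (2 * s : ℝ) = (2 * s : ℕ) by push_cast; rfl, Real.rpow_natCast]

theorem wL2_iteratedFDeriv_le_succ {d : ℕ} {f : (Fin (d + 1) → ℝ) → ℝ}
    (hf : ContDiff ℝ (⊤ : ℕ∞) f) (hc : HasCompactSupport f) (n s : ℕ) :
    wL2 d s (fun x => ‖iteratedFDeriv ℝ n f x‖) ≤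
      2 * wL2 d (s + 1 : ℕ) (fun x => ‖iteratedFDeriv ℝ (n + 1) f x‖) := by
  have hn : ContDiff ℝ 1 (iteratedFDeriv ℝ n f) :=
    hf.iteratedFDeriv_right (by exact_mod_cast le_top)
  have key := hardy_HS hn (hc.iteratedFDeriv n) s
  simp only [norm_fderiv_iteratedFDeriv] at key
  rw [wL2_natCast, wL2_natCast]
  refine (Real.sqrt_le_sqrt key).trans_eq ?_
  rw [Real.sqrt_mul (by norm_num), show (4 : ℝ) = 2 ^ 2 by norm_num,
    Real.sqrt_sq (by norm_num)]

theorem wL2_iteratedFDeriv_le {d : ℕ} {f : (Fin (d + 1) → ℝ) → ℝ}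
    (hf : ContDiff ℝ (⊤ : ℕ∞) f) (hc : HasCompactSupport f) (n s : ℕ) :
    wL2 d 0 (fun x => ‖iteratedFDeriv ℝ n f x‖) ≤
      2 ^ s * wL2 d s (fun x => ‖iteratedFDeriv ℝ (n + s) f x‖) := by
  induction s with
  | zero => simp
  | succ s ih =>
    refine ih.trans ?_
    rw [pow_succ, mul_assoc]
    exact mul_le_mul_of_nonneg_left (wL2_iteratedFDeriv_le_succ hf hc (n + s) s) (by positivity)

/-- **Weighted-to-unweighted Sobolev embedding** (Lemma 2.3): for an integer
`0 < σ ≤ j`, `H^{j,σ} ⊂ H^{j−σ}` on the half-space. -/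
theorem weighted_to_unweighted_embedding
    (d : ℕ) (j σ : ℕ) (hσ : 0 < σ) (hσj : σ ≤ j) :
    ∃ C : ℝ, 0 < C ∧
      ∀ f : (Fin (d + 1) → ℝ) → ℝ, ContDiff ℝ (⊤ : ℕ∞) f → HasCompactSupport f →
        sobNorm d (j - σ) 0 f ≤ C * sobNorm d j (σ : ℝ) f := by
  refine ⟨2 ^ σ, by positivity, fun f hf hc => ?_⟩
  unfold sobNorm
  refine (Finset.sum_le_sum fun n _ => wL2_iteratedFDeriv_le hf hc n σ).trans ?_
  rw [← Finset.mul_sum]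
  refine mul_le_mul_of_nonneg_left ?_ (by positivity)
  rw [← Finset.sum_image
    (f := fun m => wL2 d (σ : ℝ) (fun x => ‖iteratedFDeriv ℝ m f x‖))
    (g := fun n => n + σ) (fun a _ b _ h => Nat.add_right_cancel h)]
  refine Finset.sum_le_sum_of_subset_of_nonneg ?_ fun _ _ _ => Real.sqrt_nonneg _
  intro m hm
  simp only [Finset.mem_image, Finset.mem_range] at hm ⊢
  omega
end
end

section
/- Weighted Morrey-type embedding: Let j ≥ 1 be an integer, σ real with 0 < σ ≤ j, and s ≥ 0 with s ≤ j − σ − d/2, where equality is allowed only if s is not an integer. Write s = m + θ with m = ⌊s⌋ and θ ∈ [0,1). Then there is a constant C = C(d, j, σ, s) such that for every f smooth on the closed half-space and compactly supported, Σ_{|α|≤m} ‖∂^α f‖_{L^∞(H)} + Σ_{|α|=m} sup_{x≠y∈H} |∂^α f(x) − ∂^α f(y)|/|x−y|^{θ} ≤ C Σ_{|α|≤j} ‖x_d^{σ} ∂^α f‖_{L²(H)} (the Hölder term being omitted when θ = 0); i.e., H^{j,σ} ⊂ C^{s}. -/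
open MeasureTheory Set

noncomputable section

/-- The cube `[1, 2]^{d+1}`, whose points serve as the directions of integration. -/
def dirCube (d : ℕ) : Set (Fin (d + 1) → ℝ) := Icc (fun _ => 1) (fun _ => 2)

/-- The mean of `φ` over the cube `x + t • [1, 2]^{d+1}`. -/
def cubeMean {d : ℕ} (φ : (Fin (d + 1) → ℝ) → ℝ) (x : Fin (d + 1) → ℝ) (t : ℝ) : ℝ :=
  ∫ z in dirCube d, φ (x + t • z)

section cube

variable {d : ℕ}

lemma isCompact_dirCube : IsCompact (dirCube d) := isCompact_Icc

lemma measurableSet_dirCube : MeasurableSet (dirCube d) := measurableSet_Icc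

instance isProbabilityMeasure_dirCube :
    IsProbabilityMeasure (volume.restrict (dirCube d)) where
  measure_univ := by
    rw [Measure.restrict_apply_univ, dirCube, Real.volume_Icc_pi]
    norm_num

lemma one_le_of_mem_dirCube {z : Fin (d + 1) → ℝ} (hz : z ∈ dirCube d) (i : Fin (d + 1)) :
    1 ≤ z i := hz.1 i

lemma norm_le_two_of_mem_dirCube {z : Fin (d + 1) → ℝ} (hz : z ∈ dirCube d) : ‖z‖ ≤ 2 := by
  refine (pi_norm_le_iff_of_nonneg (by norm_num)).2 fun i => ?_
  rw [Real.norm_eq_abs, abs_of_nonneg (by linarith [hz.1 i])]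
  exact hz.2 i

lemma integrable_dirCube {g : (Fin (d + 1) → ℝ) → ℝ} (hg : Continuous g) :
    Integrable g (volume.restrict (dirCube d)) :=
  hg.continuousOn.integrableOn_compact isCompact_dirCube

lemma continuous_cubeMean {φ : (Fin (d + 1) → ℝ) → ℝ} (hφ : Continuous φ) :
    Continuous (fun p : (Fin (d + 1) → ℝ) × ℝ => cubeMean φ p.1 p.2) := by
  refine continuous_parametric_integral_of_continuous
    (f := fun (p : (Fin (d + 1) → ℝ) × ℝ) z => φ (p.1 + p.2 • z)) ?_ isCompact_dirCube
  simp only [Function.uncurry_def]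
  fun_prop

lemma integral_dirCube_swap {P : ℝ → (Fin (d + 1) → ℝ) → ℝ}
    (hP : Continuous (Function.uncurry P)) (a b : ℝ) :
    ∫ z in dirCube d, (∫ u in a..b, P u z) = ∫ u in a..b, (∫ z in dirCube d, P u z) := by
  refine (intervalIntegral_integral_swap ?_).symm
  rw [Measure.prod_restrict]
  exact (hP.continuousOn.integrableOn_compact
    (isCompact_uIcc.prod isCompact_dirCube)).mono_set (prod_mono uIoc_subset_uIcc subset_rfl)

lemma mem_HS_add_smul {x z : Fin (d + 1) → ℝ} (hx : x ∈ HS d) {t : ℝ} (ht : 0 ≤ t)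
    (hz : z ∈ dirCube d) : x + t • z ∈ HS d := by
  have h1 := one_le_of_mem_dirCube hz (Fin.last d)
  have h2 : 0 < x (Fin.last d) := hx
  change 0 < x (Fin.last d) + t * z (Fin.last d)
  have : 0 ≤ t * z (Fin.last d) := by positivity
  linarith

lemma measurableSet_HS : MeasurableSet (HS d) :=
  measurableSet_lt measurable_const (measurable_pi_apply _)

/-- Jensen's inequality together with the change of variables `w = x + t z` bounds cube means
by the weighted `L²` norm. -/
lemma cubeMean_le_wL2 {σ : ℝ} (hσ : 0 < σ) {φ : (Fin (d + 1) → ℝ) → ℝ} (hφ : Continuous φ)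
    (hφc : HasCompactSupport φ) {x : Fin (d + 1) → ℝ} (hx : x ∈ HS d)
    {t : ℝ} (ht : 0 < t) :
    cubeMean φ x t ≤ t ^ (-((d + 1 : ℝ) / 2 + σ)) * wL2 d σ φ := by
  set Ψ : (Fin (d + 1) → ℝ) → ℝ :=
    (HS d).indicator fun w => w (Fin.last d) ^ (2 * σ : ℝ) * φ w ^ 2 with hΨ
  have hcont : Continuous fun w : Fin (d + 1) → ℝ => w (Fin.last d) ^ (2 * σ : ℝ) * φ w ^ 2 :=
    ((continuous_apply _).rpow_const fun _ => Or.inr (by positivity)).mul (hφ.pow 2)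
  have hsupp : HasCompactSupport
      fun w : Fin (d + 1) → ℝ => w (Fin.last d) ^ (2 * σ : ℝ) * φ w ^ 2 := by
    refine hφc.mono fun w hw => ?_
    simp only [Function.mem_support, ne_eq] at hw ⊢
    exact fun h => hw (by simp [h])
  have hΨint : Integrable Ψ :=
    (hcont.integrable_of_hasCompactSupport hsupp).indicator measurableSet_HS
  have hΨnonneg : ∀ w, 0 ≤ Ψ w := 
    indicator_nonneg fun w hw => mul_nonneg
      (Real.rpow_nonneg (show 0 < w (Fin.last d) from hw).le _) (sq_nonneg _)
  have hΨwL2 : ∫ w, Ψ w = wL2 d σ φ ^ 2 := by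
    have : ∫ w, Ψ w = ∫ w in HS d, w (Fin.last d) ^ (2 * σ : ℝ) * φ w ^ 2 :=
      integral_indicator measurableSet_HS
    rw [wL2, Real.sq_sqrt, this]
    rw [← this]
    exact integral_nonneg hΨnonneg
  have hshift : Continuous fun z : Fin (d + 1) → ℝ => φ (x + t • z) := by fun_prop
  have hcomp : Integrable fun z : Fin (d + 1) → ℝ => Ψ (x + t • z) :=
    (hΨint.comp_add_left x).comp_smul ht.ne'
  have hjensen : cubeMean φ x t ^ 2 ≤ ∫ z in dirCube d, φ (x + t • z) ^ 2 :=
    (even_two.convexOn_pow (𝕜 := ℝ)).map_integral_le (by fun_prop) isClosed_univ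
      (by simp) (integrable_dirCube hshift) (integrable_dirCube (hshift.pow 2))
  have hpt : ∀ z ∈ dirCube d, φ (x + t • z) ^ 2 ≤ t ^ (-(2 * σ)) * Ψ (x + t • z) := by
    intro z hz
    have hmem := mem_HS_add_smul hx ht.le hz
    rw [hΨ, indicator_of_mem hmem, ← mul_assoc]
    refine le_mul_of_one_le_left (sq_nonneg _) ?_
    have hle : t ≤ (x + t • z) (Fin.last d) := by
      have h1 := one_le_of_mem_dirCube hz (Fin.last d)
      have h2 : 0 < x (Fin.last d) := hx
      change t ≤ x (Fin.last d) + t * z (Fin.last d)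
      nlinarith
    calc (1 : ℝ) = t ^ (-(2 * σ)) * t ^ (2 * σ) := by
          rw [← Real.rpow_add ht, neg_add_cancel, Real.rpow_zero]
      _ ≤ _ := by gcongr
  have hsq : cubeMean φ x t ^ 2 ≤ (t ^ (-((d + 1 : ℝ) / 2 + σ)) * wL2 d σ φ) ^ 2 := by
    calc cubeMean φ x t ^ 2 ≤ ∫ z in dirCube d, φ (x + t • z) ^ 2 := hjensen
      _ ≤ ∫ z in dirCube d, t ^ (-(2 * σ)) * Ψ (x + t • z) :=
          setIntegral_mono_on (integrable_dirCube (hshift.pow 2))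
            (hcomp.const_mul _).integrableOn measurableSet_dirCube hpt
      _ = t ^ (-(2 * σ)) * ∫ z in dirCube d, Ψ (x + t • z) := integral_const_mul _ _
      _ ≤ t ^ (-(2 * σ)) * ∫ z, Ψ (x + t • z) := by
          refine mul_le_mul_of_nonneg_left ?_ (by positivity)
          exact setIntegral_le_integral hcomp (ae_of_all _ fun z => hΨnonneg _)
      _ = t ^ (-(2 * σ)) * ((t ^ (d + 1))⁻¹ * wL2 d σ φ ^ 2) := by
          rw [Measure.integral_comp_smul volume (fun z => Ψ (x + z)) t,
            integral_add_left_eq_self Ψ x, hΨwL2, Module.finrank_fin_fun, smul_eq_mul,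
            abs_of_pos (by positivity)]
      _ = _ := by
          rw [mul_pow, ← Real.rpow_natCast (t ^ (-((d + 1 : ℝ) / 2 + σ))) 2,
            ← Real.rpow_mul ht.le, ← Real.rpow_natCast t (d + 1), ← Real.rpow_neg ht.le,
            ← mul_assoc, ← Real.rpow_add ht]
          congr 2
          push_cast
          ring
  exact le_of_sq_le_sq hsq (mul_nonneg (by positivity) (Real.sqrt_nonneg _))

end cube

lemma norm_sub_le_integral_norm_fderiv {V F : Type*} [NormedAddCommGroup V] [NormedSpace ℝ V]
    [NormedAddCommGroup F] [NormedSpace ℝ F] [CompleteSpace F] {G : V → F}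
    (hG : ContDiff ℝ 1 G) (p v : V) {a b : ℝ} (hab : a ≤ b) :
    ‖G (p + b • v) - G (p + a • v)‖ ≤ ‖v‖ * ∫ u in a..b, ‖fderiv ℝ G (p + u • v)‖ := by
  have hcont : Continuous fun u : ℝ => fderiv ℝ G (p + u • v) :=
    (hG.continuous_fderiv one_ne_zero).comp (by fun_prop)
  have hderiv : ∀ u : ℝ, HasDerivAt (fun u : ℝ => G (p + u • v)) (fderiv ℝ G (p + u • v) v) u := by
    intro u
    have h := ((hasDerivAt_id u).smul_const v).const_add p
    simpa [Function.comp_def] using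
      (hG.differentiable one_ne_zero _).hasFDerivAt.comp_hasDerivAt u h
  rw [← intervalIntegral.integral_eq_sub_of_hasDerivAt (fun u _ => hderiv u)
    ((hcont.clm_apply continuous_const).intervalIntegrable _ _),
    ← intervalIntegral.integral_const_mul]
  refine intervalIntegral.norm_integral_le_of_norm_le hab (ae_of_all _ fun u _ => ?_)
    ((hcont.norm.const_mul _).intervalIntegrable _ _)
  rw [mul_comm]
  exact ContinuousLinearMap.le_opNorm _ _

section derivatives

variable {d : ℕ} {f : (Fin (d + 1) → ℝ) → ℝ}

lemma continuous_norm_iteratedFDeriv (hf : ContDiff ℝ (⊤ : ℕ∞) f) (n : ℕ) :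
    Continuous fun x => ‖iteratedFDeriv ℝ n f x‖ :=
  (hf.continuous_iteratedFDeriv (mod_cast le_top)).norm

lemma norm_iteratedFDeriv_sub_le (hf : ContDiff ℝ (⊤ : ℕ∞) f) (n : ℕ)
    (p v : Fin (d + 1) → ℝ) {a b : ℝ} (hab : a ≤ b) :
    ‖iteratedFDeriv ℝ n f (p + b • v) - iteratedFDeriv ℝ n f (p + a • v)‖
      ≤ ‖v‖ * ∫ u in a..b, ‖iteratedFDeriv ℝ (n + 1) f (p + u • v)‖ := by
  simp only [← norm_fderiv_iteratedFDeriv]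
  exact norm_sub_le_integral_norm_fderiv
    (hf.iteratedFDeriv_right (m := 1) (i := n) (mod_cast le_top)) p v hab

lemma norm_iteratedFDeriv_sub_le_of_mem_dirCube (hf : ContDiff ℝ (⊤ : ℕ∞) f) (n : ℕ)
    (x : Fin (d + 1) → ℝ) {z : Fin (d + 1) → ℝ} (hz : z ∈ dirCube d) {a b : ℝ} (hab : a ≤ b) :
    ‖iteratedFDeriv ℝ n f (x + b • z) - iteratedFDeriv ℝ n f (x + a • z)‖
      ≤ 2 * ∫ u in a..b, ‖iteratedFDeriv ℝ (n + 1) f (x + u • z)‖ := by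
  refine (norm_iteratedFDeriv_sub_le hf n x z hab).trans ?_
  gcongr
  · exact intervalIntegral.integral_nonneg hab fun u _ => norm_nonneg _
  · exact norm_le_two_of_mem_dirCube hz

/-- The mean over `x + t • [1, 2]^{d+1}` of the norm of the `n`-th derivative of `f`. -/
def derivMean (f : (Fin (d + 1) → ℝ) → ℝ) (n : ℕ) (x : Fin (d + 1) → ℝ) (t : ℝ) : ℝ :=
  cubeMean (fun w => ‖iteratedFDeriv ℝ n f w‖) x t

lemma continuous_derivMean (hf : ContDiff ℝ (⊤ : ℕ∞) f) (n : ℕ) :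
    Continuous (fun p : (Fin (d + 1) → ℝ) × ℝ => derivMean f n p.1 p.2) :=
  continuous_cubeMean (continuous_norm_iteratedFDeriv hf n)

lemma continuous_integral_ray (hf : ContDiff ℝ (⊤ : ℕ∞) f) (n : ℕ)
    (x : Fin (d + 1) → ℝ) (a b : ℝ) :
    Continuous fun z => ∫ u in a..b, ‖iteratedFDeriv ℝ n f (x + u • z)‖ := by
  refine intervalIntegral.continuous_parametric_intervalIntegral_of_continuous'
    (f := fun z u => ‖iteratedFDeriv ℝ n f (x + u • z)‖) ?_ a b
  exact (continuous_norm_iteratedFDeriv hf n).comp (by fun_prop)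

lemma integral_dirCube_ray (hf : ContDiff ℝ (⊤ : ℕ∞) f) (n : ℕ)
    (x : Fin (d + 1) → ℝ) (a b : ℝ) :
    ∫ z in dirCube d, (∫ u in a..b, ‖iteratedFDeriv ℝ n f (x + u • z)‖)
      = ∫ u in a..b, derivMean f n x u := by
  refine integral_dirCube_swap (P := fun u z => ‖iteratedFDeriv ℝ n f (x + u • z)‖) ?_ a b
  exact (continuous_norm_iteratedFDeriv hf n).comp (by fun_prop)

lemma sobNorm_nonneg (d j : ℕ) (σ : ℝ) (f : (Fin (d + 1) → ℝ) → ℝ) : 0 ≤ sobNorm d j σ f :=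
  Finset.sum_nonneg fun _ _ => Real.sqrt_nonneg _

lemma derivMean_le_sobNorm {j : ℕ} {σ : ℝ} (hσ : 0 < σ) (hf : ContDiff ℝ (⊤ : ℕ∞) f)
    (hfc : HasCompactSupport f) {n : ℕ} (hn : n ≤ j) {x : Fin (d + 1) → ℝ} (hx : x ∈ HS d)
    {t : ℝ} (ht : 0 < t) :
    derivMean f n x t ≤ t ^ (-((d + 1 : ℝ) / 2 + σ)) * sobNorm d j σ f := by
  refine (cubeMean_le_wL2 hσ (continuous_norm_iteratedFDeriv hf n)
    (hfc.iteratedFDeriv n).norm hx ht).trans ?_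
  gcongr
  exact Finset.single_le_sum (f := fun n => wL2 d σ fun x => ‖iteratedFDeriv ℝ n f x‖)
    (fun _ _ => Real.sqrt_nonneg _) (Finset.mem_range.2 (Nat.lt_succ_of_le hn))

lemma derivMean_one_le_sobNorm {j : ℕ} {σ : ℝ} (hσ : 0 < σ) (hf : ContDiff ℝ (⊤ : ℕ∞) f)
    (hfc : HasCompactSupport f) {n : ℕ} (hn : n ≤ j) {x : Fin (d + 1) → ℝ} (hx : x ∈ HS d) :
    derivMean f n x 1 ≤ sobNorm d j σ f := by
  simpa using derivMean_le_sobNorm hσ hf hfc hn hx one_pos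

lemma derivMean_le_add_integral (hf : ContDiff ℝ (⊤ : ℕ∞) f) (n : ℕ)
    (x : Fin (d + 1) → ℝ) {t : ℝ} (ht : t ≤ 1) :
    derivMean f n x t ≤ derivMean f n x 1 + 2 * ∫ u in t..1, derivMean f (n + 1) x u := by
  have hc := continuous_norm_iteratedFDeriv hf n
  have h1 : Integrable (fun z => ‖iteratedFDeriv ℝ n f (x + (1 : ℝ) • z)‖)
      (volume.restrict (dirCube d)) := integrable_dirCube (hc.comp (by fun_prop))
  have h2 : Integrable (fun z => 2 * ∫ u in t..1, ‖iteratedFDeriv ℝ (n + 1) f (x + u • z)‖)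
      (volume.restrict (dirCube d)) :=
    (integrable_dirCube (continuous_integral_ray hf (n + 1) x t 1)).const_mul 2
  rw [← integral_dirCube_ray hf (n + 1) x t 1, ← integral_const_mul]
  unfold derivMean cubeMean
  rw [← integral_add h1 h2]
  refine setIntegral_mono_on (integrable_dirCube (hc.comp (by fun_prop))) (h1.add h2)
    measurableSet_dirCube fun z hz => ?_
  have h3 := norm_iteratedFDeriv_sub_le_of_mem_dirCube hf n x hz ht
  have h4 := norm_sub_norm_le (iteratedFDeriv ℝ n f (x + t • z))
    (iteratedFDeriv ℝ n f (x + (1 : ℝ) • z))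
  rw [norm_sub_rev] at h4
  linarith

/-- Downward induction on the order of differentiation turns the singularity of the top-order
mean into a decay rate for the means of lower order. -/
lemma exists_derivMean_le (d : ℕ) {j n : ℕ} {σ θ : ℝ} (hσ : 0 < σ) (hθ : θ < 1)
    (hcrit : θ ≤ (j : ℝ) - n - ((d + 1 : ℝ) / 2 + σ)) (q : ℕ) :
    ∀ i : ℕ, 1 ≤ i → n + i + q = j → ∃ K : ℝ, 0 ≤ K ∧
      ∀ f : (Fin (d + 1) → ℝ) → ℝ, ContDiff ℝ (⊤ : ℕ∞) f → HasCompactSupport f →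
        ∀ x ∈ HS d, ∀ t : ℝ, 0 < t → t ≤ 1 →
          derivMean f (n + i) x t ≤ K * sobNorm d j σ f * t ^ (θ - i) := by
  induction q with
  | zero =>
    intro i _ hij
    refine ⟨1, zero_le_one, fun f hf hfc x hx t ht ht1 => ?_⟩
    refine (derivMean_le_sobNorm (j := j) hσ hf hfc (show n + i ≤ j by omega) hx ht).trans ?_
    rw [one_mul, mul_comm]
    refine mul_le_mul_of_nonneg_left ?_ (sobNorm_nonneg _ _ _ _)
    refine Real.rpow_le_rpow_of_exponent_ge ht ht1 ?_
    have : (j : ℝ) = n + i := by rw [← hij]; push_cast; ring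
    linarith
  | succ q ih =>
    intro i hi hij
    obtain ⟨K, hK, h⟩ := ih (i + 1) (by omega) (by omega)
    have hi' : (1 : ℝ) ≤ i := mod_cast hi
    have hpos : 0 < i - θ := by linarith
    refine ⟨1 + 2 * (K / (i - θ)), by positivity, fun f hf hfc x hx t ht ht1 => ?_⟩
    have hN := sobNorm_nonneg d j σ f
    have h0 : (0 : ℝ) ∉ uIcc t 1 := by
      rw [uIcc_of_le ht1]
      exact fun h0 => absurd h0.1 (not_le.2 ht)
    have hint : ∫ u in t..1, derivMean f (n + i + 1) x u
        ≤ K * sobNorm d j σ f * (t ^ (θ - i) / (i - θ)) := by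
      calc ∫ u in t..1, derivMean f (n + i + 1) x u
          ≤ ∫ u in t..1, K * sobNorm d j σ f * u ^ (θ - (i + 1 : ℕ)) := by
            refine intervalIntegral.integral_mono_on ht1 ?_ ?_ fun u hu =>
              h f hf hfc x hx u (ht.trans_le hu.1) hu.2
            · exact ((continuous_derivMean hf _).comp
                (by fun_prop : Continuous fun u : ℝ => (x, u))).intervalIntegrable _ _
            · exact (intervalIntegral.intervalIntegrable_rpow (Or.inr h0)).const_mul _
        _ = K * sobNorm d j σ f * ((1 - t ^ (θ - i)) / (θ - i)) := by
            rw [intervalIntegral.integral_const_mul, integral_rpow (Or.inr ⟨?_, h0⟩)]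
            · push_cast
              rw [show θ - ((i : ℝ) + 1) + 1 = θ - i by ring, Real.one_rpow]
            · push_cast
              intro h
              linarith
        _ ≤ K * sobNorm d j σ f * (t ^ (θ - i) / (i - θ)) := by
            refine mul_le_mul_of_nonneg_left ?_ (by positivity)
            rw [← neg_div_neg_eq, neg_sub, neg_sub]
            gcongr
            linarith
    have hone : 1 ≤ t ^ (θ - i) := Real.one_le_rpow_of_pos_of_le_one_of_nonpos ht ht1 (by linarith)
    have h1 := derivMean_le_add_integral hf (n + i) x ht1
    have h2 := derivMean_one_le_sobNorm (j := j) hσ hf hfc (show n + i ≤ j by omega) hx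
    have h3 : sobNorm d j σ f ≤ sobNorm d j σ f * t ^ (θ - i) := le_mul_of_one_le_right hN hone
    calc derivMean f (n + i) x t
        ≤ sobNorm d j σ f * t ^ (θ - i)
          + 2 * (K * sobNorm d j σ f * (t ^ (θ - i) / (i - θ))) := by linarith
      _ = _ := by ring

lemma integral_derivMean_le (hf : ContDiff ℝ (⊤ : ℕ∞) f) {n : ℕ} {x : Fin (d + 1) → ℝ}
    {K θ r : ℝ} (hθ : 0 < θ) (hr : 0 ≤ r) (hr1 : r ≤ 1)
    (h : ∀ t : ℝ, 0 < t → t ≤ 1 → derivMean f n x t ≤ K * t ^ (θ - 1)) :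
    ∫ u in (0 : ℝ)..r, derivMean f n x u ≤ K / θ * r ^ θ := by
  calc ∫ u in (0 : ℝ)..r, derivMean f n x u ≤ ∫ u in (0 : ℝ)..r, K * u ^ (θ - 1) := by
        refine intervalIntegral.integral_mono_on_of_le_Ioo hr ?_ ?_ fun u hu =>
          h u hu.1 (hu.2.le.trans hr1)
        · exact ((continuous_derivMean hf _).comp
            (by fun_prop : Continuous fun u : ℝ => (x, u))).intervalIntegrable _ _
        · exact (intervalIntegral.intervalIntegrable_rpow' (by linarith)).const_mul _
    _ = K / θ * r ^ θ := by
        rw [intervalIntegral.integral_const_mul, integral_rpow (Or.inl (by linarith)),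
          sub_add_cancel, Real.zero_rpow hθ.ne', sub_zero]
        ring

lemma norm_iteratedFDeriv_le_of_derivMean_le (hf : ContDiff ℝ (⊤ : ℕ∞) f) {n : ℕ}
    {x : Fin (d + 1) → ℝ} {K θ : ℝ} (hθ : 0 < θ)
    (h : ∀ t : ℝ, 0 < t → t ≤ 1 → derivMean f (n + 1) x t ≤ K * t ^ (θ - 1)) :
    ‖iteratedFDeriv ℝ n f x‖ ≤ derivMean f n x 1 + 2 * (K / θ) := by
  have h1 := derivMean_le_add_integral hf n x zero_le_one
  have h2 := integral_derivMean_le hf hθ zero_le_one le_rfl h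
  have h3 : derivMean f n x 0 = ‖iteratedFDeriv ℝ n f x‖ := by
    simp [derivMean, cubeMean]
  rw [Real.one_rpow] at h2
  linarith

lemma norm_iteratedFDeriv_sub_le_of_derivMean_le (hf : ContDiff ℝ (⊤ : ℕ∞) f) {n : ℕ}
    {K θ : ℝ} (hθ : 0 < θ)
    (h : ∀ x ∈ HS d, ∀ t : ℝ, 0 < t → t ≤ 1 → derivMean f (n + 1) x t ≤ K * t ^ (θ - 1))
    {x y : Fin (d + 1) → ℝ} (hx : x ∈ HS d) (hy : y ∈ HS d) (hr : 0 < ‖x - y‖)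
    (hr1 : ‖x - y‖ ≤ 1) :
    ‖iteratedFDeriv ℝ n f x - iteratedFDeriv ℝ n f y‖
      ≤ (4 * (K / θ) + K) * ‖x - y‖ ^ θ := by
  set r := ‖x - y‖ with hrdef
  have hc := continuous_norm_iteratedFDeriv hf (n + 1)
  have hjoint : Continuous (Function.uncurry fun (u : ℝ) (z : Fin (d + 1) → ℝ) =>
      ‖iteratedFDeriv ℝ (n + 1) f ((y + r • z) + u • (x - y))‖) := by
    exact hc.comp (by fun_prop)
  have hchord : Continuous fun z : Fin (d + 1) → ℝ =>
      ∫ u in (0 : ℝ)..1, ‖iteratedFDeriv ℝ (n + 1) f ((y + r • z) + u • (x - y))‖ := by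
    refine intervalIntegral.continuous_parametric_intervalIntegral_of_continuous'
      (f := fun z u => ‖iteratedFDeriv ℝ (n + 1) f ((y + r • z) + u • (x - y))‖) ?_ 0 1
    exact hc.comp (by fun_prop)
  have hmem : ∀ u ∈ Icc (0 : ℝ) 1, y + u • (x - y) ∈ HS d := by
    intro u hu
    have hx' : 0 < x (Fin.last d) := hx
    have hy' : 0 < y (Fin.last d) := hy
    change 0 < y (Fin.last d) + u * (x (Fin.last d) - y (Fin.last d))
    rcases hu.1.eq_or_lt with rfl | hu0
    · simpa using hy'
    · nlinarith [mul_pos hu0 hx', mul_nonneg (sub_nonneg.2 hu.2) hy'.le]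
  have hrpow : r * r ^ (θ - 1) = r ^ θ := by
    rw [Real.rpow_sub_one hr.ne']
    field_simp
  have hmid : ∫ z in dirCube d, (∫ u in (0 : ℝ)..1,
      ‖iteratedFDeriv ℝ (n + 1) f ((y + r • z) + u • (x - y))‖) ≤ K * r ^ (θ - 1) := by
    rw [integral_dirCube_swap hjoint]
    calc _ = ∫ u in (0 : ℝ)..1, derivMean f (n + 1) (y + u • (x - y)) r := by
          simp only [derivMean, cubeMean, add_right_comm]
      _ ≤ ∫ _ in (0 : ℝ)..1, K * r ^ (θ - 1) := by
          refine intervalIntegral.integral_mono_on zero_le_one ?_ (by simp) fun u hu =>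
            h _ (hmem u hu) r hr hr1
          exact ((continuous_derivMean hf _).comp (by fun_prop :
            Continuous fun u : ℝ => (y + u • (x - y), r))).intervalIntegrable _ _
      _ = _ := by simp
  have hIx := integrable_dirCube (continuous_integral_ray hf (n + 1) x 0 r)
  have hIy := integrable_dirCube (continuous_integral_ray hf (n + 1) y 0 r)
  have hIm := integrable_dirCube hchord
  have hmean : ‖iteratedFDeriv ℝ n f x - iteratedFDeriv ℝ n f y‖ ≤
      ∫ z in dirCube d,
        (2 * (∫ u in (0 : ℝ)..r, ‖iteratedFDeriv ℝ (n + 1) f (x + u • z)‖)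
        + 2 * (∫ u in (0 : ℝ)..r, ‖iteratedFDeriv ℝ (n + 1) f (y + u • z)‖)
        + r * (∫ u in (0 : ℝ)..1,
            ‖iteratedFDeriv ℝ (n + 1) f ((y + r • z) + u • (x - y))‖)) := by
    calc _ = ∫ _ in dirCube d, ‖iteratedFDeriv ℝ n f x - iteratedFDeriv ℝ n f y‖ := by
          simp
      _ ≤ _ := by
          refine setIntegral_mono_on (integrable_dirCube continuous_const)
            (((hIx.const_mul 2).add (hIy.const_mul 2)).add (hIm.const_mul r))
            measurableSet_dirCube fun z hz => ?_
          have h1 := norm_iteratedFDeriv_sub_le_of_mem_dirCube hf n x hz hr.le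
          have h2 := norm_iteratedFDeriv_sub_le_of_mem_dirCube hf n y hz hr.le
          have h3 := norm_iteratedFDeriv_sub_le hf n (y + r • z) (x - y) (zero_le_one (α := ℝ))
          have h4 : y + r • z + (1 : ℝ) • (x - y) = x + r • z := by
            rw [one_smul]; abel
          rw [h4] at h3
          simp only [zero_smul, add_zero] at h1 h2 h3
          rw [norm_sub_rev] at h1
          refine le_trans ?_ (add_le_add (add_le_add h1 h2) h3)
          refine le_trans (le_of_eq ?_) (norm_add₃_le)
          congr 1
          abel
  have hX := integral_derivMean_le hf hθ hr.le hr1 (h x hx)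
  have hY := integral_derivMean_le hf hθ hr.le hr1 (h y hy)
  rw [integral_add (by simpa using! (hIx.const_mul 2).add (hIy.const_mul 2)) (hIm.const_mul r),
    integral_add (hIx.const_mul 2) (hIy.const_mul 2), integral_const_mul, integral_const_mul,
    integral_const_mul, integral_dirCube_ray hf, integral_dirCube_ray hf] at hmean
  have hM := mul_le_mul_of_nonneg_left hmid hr.le
  rw [mul_left_comm, hrpow] at hM
  calc _ ≤ 2 * (K / θ * r ^ θ) + 2 * (K / θ * r ^ θ) + K * r ^ θ := by linarith
    _ = _ := by ring

lemma exists_norm_iteratedFDeriv_le (d : ℕ) {j n : ℕ} {σ θ : ℝ} (hσ : 0 < σ) (hnj : n < j)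
    (hθ0 : 0 < θ) (hθ : θ < 1) (hcrit : θ ≤ (j : ℝ) - n - ((d + 1 : ℝ) / 2 + σ)) :
    ∃ K : ℝ, 0 ≤ K ∧
      ∀ f : (Fin (d + 1) → ℝ) → ℝ, ContDiff ℝ (⊤ : ℕ∞) f → HasCompactSupport f →
        ∀ x ∈ HS d, ‖iteratedFDeriv ℝ n f x‖ ≤ K * sobNorm d j σ f := by
  obtain ⟨K, hK, h⟩ :=
    exists_derivMean_le d hσ hθ hcrit (j - n - 1) 1 le_rfl (by omega)
  refine ⟨1 + 2 * (K / θ), by positivity, fun f hf hfc x hx => ?_⟩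
  have h1 := norm_iteratedFDeriv_le_of_derivMean_le hf hθ0
    (fun t ht ht1 => by simpa using h f hf hfc x hx t ht ht1)
  have h2 := derivMean_one_le_sobNorm (j := j) hσ hf hfc hnj.le hx
  calc _ ≤ sobNorm d j σ f + 2 * (K * sobNorm d j σ f / θ) := by linarith
    _ = _ := by ring

lemma exists_norm_iteratedFDeriv_sub_le (d : ℕ) {j n : ℕ} {σ θ : ℝ} (hσ : 0 < σ) (hnj : n < j)
    (hθ0 : 0 < θ) (hθ : θ < 1) (hcrit : θ ≤ (j : ℝ) - n - ((d + 1 : ℝ) / 2 + σ)) :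
    ∃ K : ℝ, 0 ≤ K ∧
      ∀ f : (Fin (d + 1) → ℝ) → ℝ, ContDiff ℝ (⊤ : ℕ∞) f → HasCompactSupport f →
        ∀ x ∈ HS d, ∀ y ∈ HS d, ‖x - y‖ ≤ 1 →
          ‖iteratedFDeriv ℝ n f x - iteratedFDeriv ℝ n f y‖
            ≤ K * sobNorm d j σ f * ‖x - y‖ ^ θ := by
  obtain ⟨K, hK, h⟩ :=
    exists_derivMean_le d hσ hθ hcrit (j - n - 1) 1 le_rfl (by omega)
  refine ⟨4 * (K / θ) + K, by positivity, fun f hf hfc x hx y hy hr1 => ?_⟩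
  rcases eq_or_ne x y with rfl | hxy
  · simp [Real.zero_rpow hθ0.ne']
  refine (norm_iteratedFDeriv_sub_le_of_derivMean_le hf (K := K * sobNorm d j σ f) hθ0
    (fun x hx t ht ht1 => by simpa using h f hf hfc x hx t ht ht1) hx hy
    (norm_pos_iff.2 (sub_ne_zero.2 hxy)) hr1).trans (le_of_eq ?_)
  ring

end derivatives

/-- **Weighted Morrey-type embedding** (Lemma 2.4): for `0 < σ ≤ j` and
`0 ≤ s ≤ j − σ − d/2` (equality only when `s` is not an integer), `H^{j,σ} ⊂ C^s`
on the half-space: writing `s = m + θ`, `m = ⌊s⌋`, all derivatives up to order `m` are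
bounded and the `m`-th derivative is `θ`-Hölder, with constants controlled by the
`H^{j,σ}` norm. -/
theorem weighted_morrey_embedding
    (d : ℕ) (j : ℕ) (σ s : ℝ) (hσ : 0 < σ) (hσj : σ ≤ (j : ℝ)) (hs : 0 ≤ s)
    (hcrit : s ≤ (j : ℝ) - σ - (d + 1 : ℝ) / 2)
    (heq : s = (j : ℝ) - σ - (d + 1 : ℝ) / 2 → ∀ n : ℕ, (n : ℝ) ≠ s) :
    ∃ C : ℝ, 0 < C ∧
      ∀ f : (Fin (d + 1) → ℝ) → ℝ, ContDiff ℝ (⊤ : ℕ∞) f → HasCompactSupport f →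
        (∀ x ∈ HS d,
          ∑ n ∈ Finset.range (⌊s⌋₊ + 1), ‖iteratedFDeriv ℝ n f x‖ ≤ C * sobNorm d j σ f) ∧
        ∀ x ∈ HS d, ∀ y ∈ HS d,
          ‖iteratedFDeriv ℝ ⌊s⌋₊ f x - iteratedFDeriv ℝ ⌊s⌋₊ f y‖
            ≤ C * sobNorm d j σ f * ‖x - y‖ ^ (s - ⌊s⌋₊ : ℝ) := by
  set m := ⌊s⌋₊ with hm
  have hms : (m : ℝ) ≤ s := Nat.floor_le hs
  have hsm : s < m + 1 := Nat.lt_floor_add_one s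
  have hgap : 0 < (j : ℝ) - m - ((d + 1 : ℝ) / 2 + σ) := by
    rcases hcrit.lt_or_eq with h | h
    · linarith
    · have := lt_of_le_of_ne hms (heq h m)
      linarith
  have hdim : 0 < (d + 1 : ℝ) / 2 + σ := by positivity
  have hmj : m < j := by
    have : (m : ℝ) < j := by linarith
    exact_mod_cast this
  set ε := min (1 / 2) ((j : ℝ) - m - ((d + 1 : ℝ) / 2 + σ)) with hε
  have hε0 : 0 < ε := lt_min (by norm_num) hgap
  have hε1 : ε < 1 := (min_le_left _ _).trans_lt (by norm_num)
  have hsup : ∀ n, ∃ K : ℝ, n ≤ m → 0 ≤ K ∧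
      ∀ f : (Fin (d + 1) → ℝ) → ℝ, ContDiff ℝ (⊤ : ℕ∞) f → HasCompactSupport f →
        ∀ x ∈ HS d, ‖iteratedFDeriv ℝ n f x‖ ≤ K * sobNorm d j σ f := by
    intro n
    by_cases hn : n ≤ m
    · have hn' : (n : ℝ) ≤ m := mod_cast hn
      obtain ⟨K, hK⟩ := exists_norm_iteratedFDeriv_le d (j := j) (n := n) hσ (by omega) hε0 hε1
        ((min_le_right _ _).trans (by linarith))
      exact ⟨K, fun _ => hK⟩
    · exact ⟨0, fun h => absurd h hn⟩
  choose K hK using hsup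
  have hKm := hK m le_rfl
  have hS0 : 0 ≤ ∑ n ∈ Finset.range (m + 1), K n :=
    Finset.sum_nonneg fun n hn => (hK n (Nat.lt_succ_iff.1 (Finset.mem_range.1 hn))).1
  have hHolder : ∃ L : ℝ, 0 ≤ L ∧
      ∀ f : (Fin (d + 1) → ℝ) → ℝ, ContDiff ℝ (⊤ : ℕ∞) f → HasCompactSupport f →
        ∀ x ∈ HS d, ∀ y ∈ HS d,
          ‖iteratedFDeriv ℝ m f x - iteratedFDeriv ℝ m f y‖
            ≤ L * sobNorm d j σ f * ‖x - y‖ ^ (s - m : ℝ) := by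
    have hfar : ∀ f : (Fin (d + 1) → ℝ) → ℝ, ContDiff ℝ (⊤ : ℕ∞) f → HasCompactSupport f →
        ∀ x ∈ HS d, ∀ y ∈ HS d, 1 ≤ ‖x - y‖ ^ (s - m : ℝ) →
          ‖iteratedFDeriv ℝ m f x - iteratedFDeriv ℝ m f y‖
            ≤ 2 * K m * sobNorm d j σ f * ‖x - y‖ ^ (s - m : ℝ) := by
      intro f hf hfc x hx y hy h1
      have hN := sobNorm_nonneg d j σ f
      have hle : 0 ≤ 2 * K m * sobNorm d j σ f := by
        have := hKm.1
        positivity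
      refine le_trans ?_ (le_mul_of_one_le_right hle h1)
      linarith [norm_sub_le (iteratedFDeriv ℝ m f x) (iteratedFDeriv ℝ m f y),
        hKm.2 f hf hfc x hx, hKm.2 f hf hfc y hy]
    rcases hms.eq_or_lt with h0 | h0
    · refine ⟨2 * K m, by linarith [hKm.1], fun f hf hfc x hx y hy => ?_⟩
      exact hfar f hf hfc x hx y hy (by simp [h0])
    · obtain ⟨L, hL, h⟩ := exists_norm_iteratedFDeriv_sub_le d (j := j) (n := m) (θ := s - m)
        hσ hmj (by linarith) (by linarith) (by linarith)
      refine ⟨L + 2 * K m, by linarith [hKm.1], fun f hf hfc x hx y hy => ?_⟩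
      have hN := sobNorm_nonneg d j σ f
      have hP : 0 ≤ ‖x - y‖ ^ (s - m : ℝ) := by positivity
      have h1 : 0 ≤ L * sobNorm d j σ f * ‖x - y‖ ^ (s - m : ℝ) := by positivity
      have h2 : 0 ≤ 2 * K m * sobNorm d j σ f * ‖x - y‖ ^ (s - m : ℝ) := by
        have := hKm.1
        positivity
      rw [add_mul, add_mul]
      rcases le_total ‖x - y‖ 1 with hr | hr
      · linarith [h f hf hfc x hx y hy hr]
      · linarith [hfar f hf hfc x hx y hy (Real.one_le_rpow hr (by linarith))]
  obtain ⟨L, hL, hHolder⟩ := hHolder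
  refine ⟨∑ n ∈ Finset.range (m + 1), K n + L + 1, by positivity, fun f hf hfc => ⟨?_, ?_⟩⟩
  · intro x hx
    have hN := sobNorm_nonneg d j σ f
    calc _ ≤ ∑ n ∈ Finset.range (m + 1), K n * sobNorm d j σ f :=
          Finset.sum_le_sum fun n hn =>
            (hK n (Nat.lt_succ_iff.1 (Finset.mem_range.1 hn))).2 f hf hfc x hx
      _ = (∑ n ∈ Finset.range (m + 1), K n) * sobNorm d j σ f := (Finset.sum_mul ..).symm
      _ ≤ _ := by
          gcongr
          linarith
  · intro x hx y hy
    have hN := sobNorm_nonneg d j σ f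
    refine (hHolder f hf hfc x hx y hy).trans ?_
    gcongr
    linarith
end
end
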